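/- (Lemma 3.1, majority voting, lower bound / attainment for each target set.) Let d, n be positive integers, let g_1, …, g_n be vectors in the Euclidean space ℝ^d that are pairwise orthogonal, and let γ_1, …, γ_n > 0 and ε > 0 be real numbers. For every subset K ⊆ {1, …, n} with |K| = ⌈n/2⌉ such that not all g_j with j ∈ K are zero, setting k_K = min(d, ⌊ε² · (Σ_{j∈K} ‖g_j‖₂²) / (Σ_{j∈K} γ_j)²⌋), if k_K ≥ 1 then there exist pairwise orthogonal vectors r_1, …, r_{k_K} in ℝ^d such that ‖r_i‖₂ ≤ ε and ⟨Σ_{j∈K} g_j, r_i⟩ ≥ Σ_{j∈K} γ_j for every 1 ≤ i ≤ k_K. In particular, the maximal number of such orthogonal perturbations is at least min(d, ⌊ min over subsets K' with |K'| = ⌈n/2⌉ of ε² · (Σ_{j∈K'} ‖g_j‖₂²) / (Σ_{j∈K'} γ_j)² ⌋) whenever all g_j are nonzero. -/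

import Mathlib

open scoped RealInnerProductSpace

/-- A vector `v` of `ℝ^d` has the same inner product `‖v‖ / √k` with each member of a suitable
orthonormal family of size `k ≤ d`. -/
theorem exists_orthonormal_inner_eq_norm_div_sqrt {d k : ℕ} (hk : 0 < k) (hkd : k ≤ d)
    (v : EuclideanSpace ℝ (Fin d)) :
    ∃ e : Fin k → EuclideanSpace ℝ (Fin d), Orthonormal ℝ e ∧ ∀ i, ⟪v, e i⟫ = ‖v‖ / √k := by
  have hb : Orthonormal ℝ fun i : Fin k => EuclideanSpace.basisFun (Fin d) ℝ (Fin.castLE hkd i) :=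
    (EuclideanSpace.basisFun (Fin d) ℝ).orthonormal.comp _ (Fin.castLE_injective hkd)
  set b : Fin k → EuclideanSpace ℝ (Fin d) :=
    fun i => EuclideanSpace.basisFun (Fin d) ℝ (Fin.castLE hkd i)
  have hk' : (0 : ℝ) < k := Nat.cast_pos.mpr hk
  set u : EuclideanSpace ℝ (Fin d) := ∑ i, (‖v‖ / √k) • b i with hu
  have hui (i : Fin k) : ⟪u, b i⟫ = ‖v‖ / √k := by
    rw [hu, hb.inner_left_fintype]
    rfl
  have hnorm : ‖u‖ = ‖v‖ := by
    refine (sq_eq_sq₀ (norm_nonneg _) (norm_nonneg _)).mp ?_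
    have h : ⟪u, u⟫ = ∑ _i : Fin k, (‖v‖ / √k) * (‖v‖ / √k) := by
      conv_lhs => rw [hu, hb.inner_sum]
      rfl
    rw [← real_inner_self_eq_norm_sq, h, Finset.sum_const, Finset.card_univ, Fintype.card_fin,
      nsmul_eq_mul, ← pow_two, div_pow, Real.sq_sqrt hk'.le]
    field_simp
  let T := (Submodule.span ℝ {u - v})ᗮ.reflection
  have hT : T u = v := Submodule.reflection_sub hnorm
  refine ⟨fun i => T (b i), hb.comp_linearIsometryEquiv T, fun i => ?_⟩
  rw [← hui i, ← T.inner_map_map u (b i), hT]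

theorem exists_orthogonal_le_inner {d k : ℕ} (hkd : k ≤ d) (v : EuclideanSpace ℝ (Fin d))
    {ε S : ℝ} (hε : 0 ≤ ε) (hS : k * S ^ 2 ≤ ε ^ 2 * ‖v‖ ^ 2) :
    ∃ r : Fin k → EuclideanSpace ℝ (Fin d),
      (∀ i j, i ≠ j → ⟪r i, r j⟫ = 0) ∧ (∀ i, ‖r i‖ ≤ ε) ∧ (∀ i, S ≤ ⟪v, r i⟫) := by
  rcases k.eq_zero_or_pos with rfl | hk
  · exact ⟨0, fun i => i.elim0, fun i => i.elim0, fun i => i.elim0⟩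
  obtain ⟨e, he, hve⟩ := exists_orthonormal_inner_eq_norm_div_sqrt hk hkd v
  have hk' : (0 : ℝ) < k := Nat.cast_pos.mpr hk
  refine ⟨fun i => ε • e i, fun i j hij => ?_, fun i => ?_, fun i => ?_⟩
  · simp [real_inner_smul_left, real_inner_smul_right, he.inner_eq_zero hij]
  · simp [norm_smul, he.norm_eq_one i, abs_of_nonneg hε]
  · rw [real_inner_smul_right, hve]
    refine le_of_abs_le (abs_le_of_sq_le_sq ?_ (by positivity))
    rw [mul_pow, div_pow, Real.sq_sqrt hk'.le, ← mul_div_assoc, le_div_iff₀ hk']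
    linarith

theorem norm_sum_sq_of_pairwise_orthogonal {ι E : Type*} [NormedAddCommGroup E]
    [InnerProductSpace ℝ E] (K : Finset ι) {g : ι → E} (hg : ∀ i j, i ≠ j → ⟪g i, g j⟫ = 0) :
    ‖∑ j ∈ K, g j‖ ^ 2 = ∑ j ∈ K, ‖g j‖ ^ 2 := by
  classical
  rw [← real_inner_self_eq_norm_sq, sum_inner]
  refine Finset.sum_congr rfl fun i hi => ?_
  rw [inner_sum, Finset.sum_eq_single_of_mem i hi fun j _ hj => hg i j hj.symm,
    real_inner_self_eq_norm_sq]

/-- Perturbations for the target set `K`, up to the size allowed by the budget `ε`. -/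
theorem exists_orthogonal_perturbations {ι : Type*} {d : ℕ} (K : Finset ι)
    {g : ι → EuclideanSpace ℝ (Fin d)} (hg : ∀ i j, i ≠ j → ⟪g i, g j⟫ = 0)
    (γ : ι → ℝ) {ε : ℝ} (hε : 0 ≤ ε) {k : ℕ}
    (hk : k = min d (⌊ε ^ 2 * (∑ j ∈ K, ‖g j‖ ^ 2) / (∑ j ∈ K, γ j) ^ 2⌋.toNat)) :
    ∃ r : Fin k → EuclideanSpace ℝ (Fin d),
      (∀ i j, i ≠ j → ⟪r i, r j⟫ = 0) ∧ (∀ i, ‖r i‖ ≤ ε) ∧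
      (∀ i, (∑ j ∈ K, γ j) ≤ ⟪∑ j ∈ K, g j, r i⟫) := by
  refine exists_orthogonal_le_inner (hk ▸ min_le_left _ _) _ hε ?_
  rw [norm_sum_sq_of_pairwise_orthogonal K hg]
  refine mul_le_of_le_div₀ (by positivity) (by positivity) ?_
  have hkx := hk.trans_le (min_le_right _ _)
  rw [Int.floor_toNat] at hkx
  exact (Nat.cast_le.mpr hkx).trans (Nat.floor_le (by positivity))

/-- Lemma 3.1, majority voting, lower bound / attainment: for every target set K of
⌈n/2⌉ models (with not all targeted gradients zero), k_K = min(d, ⌊ε² (Σ_{j∈K}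
‖g_j‖²)/(Σ_{j∈K} γ_j)²⌋) orthogonal perturbations attaining the aggregated adversarial
condition exist whenever k_K ≥ 1; in particular, if all g_j are nonzero, the maximal
number of such perturbations is at least min(d, ⌊min_{|K'|=⌈n/2⌉} ε² (Σ_{j∈K'}
‖g_j‖²)/(Σ_{j∈K'} γ_j)²⌋). -/
theorem stmt_6 (d n : ℕ) (hd : 0 < d) (hn : 0 < n)
    (g : Fin n → EuclideanSpace ℝ (Fin d))
    (hgorth : ∀ i j, i ≠ j → ⟪g i, g j⟫ = 0)
    (γ : Fin n → ℝ) (hγ : ∀ j, 0 < γ j)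
    (ε : ℝ) (hε : 0 < ε) :
    (∀ K : Finset (Fin n), K.card = (n + 1) / 2 → (∃ j ∈ K, g j ≠ 0) →
      ∀ kK : ℕ,
        kK = min d (⌊ε ^ 2 * (∑ j ∈ K, ‖g j‖ ^ 2) / (∑ j ∈ K, γ j) ^ 2⌋.toNat) →
        1 ≤ kK →
        ∃ r : Fin kK → EuclideanSpace ℝ (Fin d),
          (∀ i j, i ≠ j → ⟪r i, r j⟫ = 0) ∧
          (∀ i, ‖r i‖ ≤ ε) ∧
          (∀ i, (∑ j ∈ K, γ j) ≤ ⟪∑ j ∈ K, g j, r i⟫)) ∧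
    ((∀ j, g j ≠ 0) →
      ∀ m : ℕ,
        m = min d (⌊sInf {x : ℝ | ∃ K' : Finset (Fin n), K'.card = (n + 1) / 2 ∧
              x = ε ^ 2 * (∑ j ∈ K', ‖g j‖ ^ 2) / (∑ j ∈ K', γ j) ^ 2}⌋.toNat) →
        ∃ K : Finset (Fin n), K.card = (n + 1) / 2 ∧
          ∃ r : Fin m → EuclideanSpace ℝ (Fin d),
            (∀ i j, i ≠ j → ⟪r i, r j⟫ = 0) ∧
            (∀ i, ‖r i‖ ≤ ε) ∧
            (∀ i, (∑ j ∈ K, γ j) ≤ ⟪∑ j ∈ K, g j, r i⟫)) := by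
  refine ⟨fun K _ _ k hk _ => exists_orthogonal_perturbations K hgorth γ hε.le hk,
    fun _ m hm => ?_⟩
  set A : Set ℝ := {x : ℝ | ∃ K' : Finset (Fin n), K'.card = (n + 1) / 2 ∧
    x = ε ^ 2 * (∑ j ∈ K', ‖g j‖ ^ 2) / (∑ j ∈ K', γ j) ^ 2}
  have hfin : A.Finite :=
    (Set.finite_range fun K' : Finset (Fin n) =>
      ε ^ 2 * (∑ j ∈ K', ‖g j‖ ^ 2) / (∑ j ∈ K', γ j) ^ 2).subset
      fun x ⟨K', _, hx⟩ => ⟨K', hx.symm⟩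
  obtain ⟨K₀, -, hK₀⟩ := Finset.exists_subset_card_eq
    (s := (Finset.univ : Finset (Fin n))) (n := (n + 1) / 2) (by simp; omega)
  obtain ⟨K, hK, hx⟩ := Set.Nonempty.csInf_mem (s := A) ⟨_, K₀, hK₀, rfl⟩ hfin
  rw [hx] at hm
  exact ⟨K, hK, exists_orthogonal_perturbations K hgorth γ hε.le hm⟩
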